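/- Let X ∈ ℝ^{n×d} be full-rank with Gram matrix K = XXᵀ having smallest nonzero eigenvalue σ_min(K) > 0, and let X̃ ∈ ℝ^{n×d} be another full-rank matrix with Gram matrix K̃ = X̃X̃ᵀ. Suppose the d nonzero eigenvalues of K̃ all exceed σ_min(K) plus the gap required by the Davis–Kahan sin(Θ) theorem (precisely, apply Davis–Kahan with interval (σ_min(K), ∞) and separation δ = σ_min(K)). Then 1 − E(X, X̃) ≤ ‖K̃ − K‖_F² / (d·σ_min(K)²). -/

import Mathlib

open MeasureTheory Matrix ProbabilityTheory

noncomputable section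

/-- Squared Frobenius norm of a matrix. -/
def frobSq {m k : ℕ} (A : Matrix (Fin m) (Fin k) ℝ) : ℝ := ∑ i, ∑ j, (A i j) ^ 2

theorem frobSq_trace {m k : ℕ} (A : Matrix (Fin m) (Fin k) ℝ) :
    frobSq A = (Aᵀ * A).trace := by
  unfold frobSq
  rw [Finset.sum_comm]
  simp [Matrix.trace, Matrix.mul_apply, pow_two]

theorem frobSq_nonneg' {m k : ℕ} (A : Matrix (Fin m) (Fin k) ℝ) : 0 ≤ frobSq A := by
  unfold frobSq
  positivity

theorem frobSq_transpose' {m k : ℕ} (A : Matrix (Fin m) (Fin k) ℝ) : frobSq Aᵀ = frobSq A := by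
  unfold frobSq
  rw [Finset.sum_comm]
  rfl

theorem frobSq_proj {n d k : ℕ} (U : Matrix (Fin n) (Fin d) ℝ) (hU : Uᵀ * U = 1)
    (A : Matrix (Fin n) (Fin k) ℝ) :
    frobSq (A - U * Uᵀ * A) = frobSq A - frobSq (Uᵀ * A) := by
  rw [frobSq_trace, frobSq_trace, frobSq_trace, ← Matrix.trace_sub]
  congr 1
  have h : Aᵀ * (U * Uᵀ * (U * Uᵀ * A)) = Aᵀ * (U * Uᵀ * A) := by
    have : U * Uᵀ * (U * Uᵀ * A) = U * (Uᵀ * U) * Uᵀ * A := by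
      simp only [Matrix.mul_assoc]
    rw [this, hU, Matrix.mul_one]
  simp only [Matrix.transpose_sub, Matrix.transpose_mul, Matrix.transpose_transpose,
    Matrix.sub_mul, Matrix.mul_sub]
  simp only [Matrix.mul_assoc] at h ⊢
  rw [h]
  abel

/-- Let `X ∈ ℝ^{n×d}` be full rank with Gram matrix `K = XXᵀ` having
smallest nonzero eigenvalue `σ_min(K) > 0`, and let `X̃ ∈ ℝ^{n×d}` be full rank with Gram
matrix `K̃ = X̃X̃ᵀ` whose `d` nonzero eigenvalues all exceed `σ_min(K)` plus the separation
`δ = σ_min(K)` required by the Davis–Kahan `sin Θ` theorem.  Then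
`1 − E(X, X̃) ≤ ‖K̃ − K‖_F²/(d σ_min(K)²)`, where `E(X, X̃) = (1/max(d,d))‖Uᵀ Ũ‖_F²` for
the leading eigenvector matrices `U`, `Ũ` of `K`, `K̃`. -/
theorem overlap_davis_kahan_bound
    {n d : ℕ}
    (X Xt U Ut : Matrix (Fin n) (Fin d) ℝ)
    (Lam Lamt : Matrix (Fin d) (Fin d) ℝ)
    (σmin : ℝ)
    -- X and X̃ are full rank
    (hXrank : X.rank = d) (hXtrank : Xt.rank = d)
    -- U is the (orthonormal) leading eigenvector matrix of K = XXᵀ, with eigenvalues Λ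
    (hU : Uᵀ * U = 1)
    (hLamdiag : ∀ i j, i ≠ j → Lam i j = 0)
    (hUeig : X * Xᵀ * U = U * Lam)
    (hUspan : U * Uᵀ * X = X)
    -- Ũ is the (orthonormal) leading eigenvector matrix of K̃ = X̃X̃ᵀ, with eigenvalues Λ̃
    (hUt : Utᵀ * Ut = 1)
    (hLamtdiag : ∀ i j, i ≠ j → Lamt i j = 0)
    (hUteig : Xt * Xtᵀ * Ut = Ut * Lamt)
    (hUtspan : Ut * Utᵀ * Xt = Xt)
    -- σ_min(K) is the smallest nonzero eigenvalue of K, and it is positive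
    (hσpos : 0 < σmin)
    (hσle : ∀ i, σmin ≤ Lam i i)
    (hσmem : ∃ i, Lam i i = σmin)
    -- the d nonzero eigenvalues of K̃ all exceed σ_min(K) plus the separation δ = σ_min(K)
    (hgap : ∀ i, σmin + σmin < Lamt i i) :
    1 - (1 / (max d d : ℝ)) * frobSq (Uᵀ * Ut)
      ≤ frobSq (Xt * Xtᵀ - X * Xᵀ) / ((d : ℝ) * σmin ^ 2) := by
  have hd : 0 < d := by
    obtain ⟨i, _⟩ := hσmem
    exact i.pos
  have hdR : (0 : ℝ) < d := by exact_mod_cast hd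
  have hUtd : frobSq Ut = d := by
    rw [frobSq_trace, hUt]
    simp
  set M := Xt * Xtᵀ - X * Xᵀ with hM
  set R := Ut - U * Uᵀ * Ut with hR
  have hRn : frobSq R = d - frobSq (Uᵀ * Ut) := by
    rw [hR, frobSq_proj U hU, hUtd]
  have hRL : R * Lamt = M * Ut - U * Uᵀ * (M * Ut) := by
    have h1 : M * Ut = Ut * Lamt - X * Xᵀ * Ut := by
      rw [hM, Matrix.sub_mul, hUteig]
    have h2 : U * Uᵀ * (X * Xᵀ * Ut) = X * Xᵀ * Ut := by
      rw [← Matrix.mul_assoc, ← Matrix.mul_assoc, hUspan]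
    rw [h1, Matrix.mul_sub, h2, hR, Matrix.sub_mul, Matrix.mul_assoc (U * Uᵀ)]
    abel
  have hle1 : frobSq (R * Lamt) ≤ frobSq (M * Ut) := by
    rw [hRL, frobSq_proj U hU]
    linarith [frobSq_nonneg' (Uᵀ * (M * Ut))]
  have hle2 : frobSq (M * Ut) ≤ frobSq M := by
    have h := frobSq_proj Ut hUt Mᵀ
    have h3 := frobSq_nonneg' (Mᵀ - Ut * Utᵀ * Mᵀ)
    rw [← Matrix.transpose_mul, frobSq_transpose', frobSq_transpose'] at h
    linarith
  have hle3 : σmin ^ 2 * frobSq R ≤ frobSq (R * Lamt) := by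
    unfold frobSq
    rw [Finset.mul_sum]
    refine Finset.sum_le_sum fun i _ => ?_
    rw [Finset.mul_sum]
    refine Finset.sum_le_sum fun j _ => ?_
    have hj : (R * Lamt) i j = R i j * Lamt j j := by
      rw [Matrix.mul_apply, Finset.sum_eq_single j]
      · intro b _ hb
        rw [hLamtdiag b j hb, mul_zero]
      · simp
    rw [hj, mul_pow, mul_comm]
    have : σmin ≤ Lamt j j := by linarith [hgap j]
    gcongr
  rw [max_self, le_div_iff₀ (by positivity)]
  have e : (1 - 1 / (d : ℝ) * frobSq (Uᵀ * Ut)) * (d * σmin ^ 2) = σmin ^ 2 * frobSq R := by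
    rw [hRn]
    field_simp
  rw [e]
  linarith

end
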